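/- arXiv:1210.4539 — 4 statements merged into one kernel-verified Lean document; each statement's English description precedes it below -/
import Mathlib

section
/- Let α > 0 and Ω > α be real numbers, let u be a real number (the unit roundoff) and let ε = 2u satisfy 0 < 4ε < 1 − u. Assume α = 4ε/((1 − u)·Ω). Let b, c, d be real numbers in the interval [α, Ω] with d ≤ c. If d/c < α and b/c < α, then (b·d)/c < α. -/
/-- Proposition 1 ('Improved Complex Division'). -/
theorem improved_complex_division
    (α Ω u ε : ℝ) (hα : 0 < α) (hΩ : α < Ω)
    (hε : ε = 2 * u) (hε0 : 0 < 4 * ε) (hε1 : 4 * ε < 1 - u)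
    (hαdef : α = 4 * ε / ((1 - u) * Ω))
    (b c d : ℝ)
    (hb : b ∈ Set.Icc α Ω) (hc : c ∈ Set.Icc α Ω) (hd : d ∈ Set.Icc α Ω)
    (hdc : d ≤ c)
    (h1 : d / c < α) (h2 : b / c < α) :
    (b * d) / c < α := by
  have hc0 : 0 < c := hα.trans_le hc.1
  have hΩ0 : 0 < Ω := hα.trans hΩ
  have hu : 0 < 1 - u := hε0.trans hε1
  have hαΩ : α * Ω < 1 := by
    have h : α * Ω = 4 * ε / (1 - u) := by
      rw [hαdef]
      field_simp
    rwa [h, div_lt_one hu]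
  have hd1 : d < 1 :=
    calc d < α * c := (div_lt_iff₀ hc0).mp h1
      _ ≤ α * Ω := by gcongr; exact hc.2
      _ < 1 := hαΩ
  have hb0 : 0 < b / c := div_pos (hα.trans_le hb.1) hc0
  calc b * d / c = b / c * d := mul_div_right_comm b d c
    _ < b / c := mul_lt_of_lt_one_right hb0 hd1
    _ < α := h2
end

section
/- Let α > 0 and Ω > α be real numbers, let u be a real number and let ε = 2u satisfy 0 < 4ε < 1 − u. Assume α = 4ε/((1 − u)·Ω). Let b, c, d be nonzero real numbers whose absolute values |b|, |c|, |d| lie in the interval [α, Ω], and assume |d| ≤ |c|. If |d/c| < α and |b/c| < α, then |(b·d)/c| < α. -/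
/-- Proposition 1 extended to signed numbers in `[-Ω, -α] ∪ [α, Ω]`. -/
theorem improved_complex_division_signed
    (α Ω u ε : ℝ) (hα : 0 < α) (hΩ : α < Ω)
    (hε : ε = 2 * u) (hε0 : 0 < 4 * ε) (hε1 : 4 * ε < 1 - u)
    (hαdef : α = 4 * ε / ((1 - u) * Ω))
    (b c d : ℝ) (hb0 : b ≠ 0) (hc0 : c ≠ 0) (hd0 : d ≠ 0)
    (hb : |b| ∈ Set.Icc α Ω) (hc : |c| ∈ Set.Icc α Ω) (hd : |d| ∈ Set.Icc α Ω)
    (hdc : |d| ≤ |c|)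
    (h1 : |d / c| < α) (h2 : |b / c| < α) :
    |(b * d) / c| < α := by
  have hu : 0 < 1 - u := hε0.trans hε1
  have hΩ0 : 0 < Ω := hα.trans hΩ
  have hαΩ : α * Ω < 1 := by
    have h : α * Ω = 4 * ε / (1 - u) := by
      rw [hαdef]
      field_simp
    rw [h, div_lt_one hu]
    exact hε1
  have hc_pos : 0 < |c| := abs_pos.mpr hc0
  have hd_lt : |d| < 1 := by
    rw [abs_div, div_lt_iff₀ hc_pos] at h1
    calc |d| < α * |c| := h1
      _ ≤ α * Ω := by gcongr; exact hc.2
      _ < 1 := hαΩ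
  calc |b * d / c| = |b / c| * |d| := by rw [← abs_mul, div_mul_eq_mul_div]
    _ ≤ |b / c| := mul_le_of_le_one_right (abs_nonneg _) hd_lt.le
    _ < α := h2
end

section
/- Let α = 2^(−1074), Ω = (2 − 2^(−52))·2^(1023). Let b, c, d be nonzero real numbers whose absolute values |b|, |c|, |d| lie in the interval [α, Ω], and assume |d| ≤ |c|. If |d/c| < α and |b/c| < α, then |(b·d)/c| < α. -/
/-- If `d / c` and `b / c` both underflow below `α` and `|c| ≤ Ω` with `α * Ω ≤ 1`, then
`b * d / c` underflows as well. -/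
theorem abs_mul_div_lt_of_abs_div_lt {K : Type*} [Field K] [LinearOrder K] [IsStrictOrderedRing K]
    {α Ω b c d : K} (hαΩ : α * Ω ≤ 1) (hc0 : c ≠ 0) (hc : |c| ≤ Ω)
    (hd : |d / c| < α) (hb : |b / c| < α) : |b * d / c| < α := by
  have hα : 0 < α := (abs_nonneg _).trans_lt hd
  have hb1 : |b| ≤ 1 :=
    calc |b| = |b / c| * |c| := by rw [← abs_mul, div_mul_cancel₀ b hc0]
      _ ≤ α * Ω := mul_le_mul hb.le hc (abs_nonneg c) hα.le
      _ ≤ 1 := hαΩ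
  calc |b * d / c| = |b| * |d / c| := by rw [mul_div_assoc, abs_mul]
    _ ≤ |d / c| := mul_le_of_le_one_left (abs_nonneg _) hb1
    _ < α := hd

/-- The smallest subnormal times the largest finite binary64 number is at most one. -/
theorem binary64_min_mul_max_le_one :
    (2 : ℝ) ^ (-1074 : ℤ) * ((2 - (2 : ℝ) ^ (-52 : ℤ)) * 2 ^ (1023 : ℤ)) ≤ 1 := by
  rw [mul_left_comm, ← zpow_add₀ two_ne_zero]
  norm_num

/-- Proposition 1 instantiated with the IEEE 754 binary64 parameters. -/
theorem improved_complex_division_binary64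
    (b c d : ℝ) (hb0 : b ≠ 0) (hc0 : c ≠ 0) (hd0 : d ≠ 0)
    (hb : |b| ∈ Set.Icc ((2 : ℝ) ^ (-1074 : ℤ)) ((2 - (2 : ℝ) ^ (-52 : ℤ)) * 2 ^ (1023 : ℤ)))
    (hc : |c| ∈ Set.Icc ((2 : ℝ) ^ (-1074 : ℤ)) ((2 - (2 : ℝ) ^ (-52 : ℤ)) * 2 ^ (1023 : ℤ)))
    (hd : |d| ∈ Set.Icc ((2 : ℝ) ^ (-1074 : ℤ)) ((2 - (2 : ℝ) ^ (-52 : ℤ)) * 2 ^ (1023 : ℤ)))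
    (hdc : |d| ≤ |c|)
    (h1 : |d / c| < (2 : ℝ) ^ (-1074 : ℤ))
    (h2 : |b / c| < (2 : ℝ) ^ (-1074 : ℤ)) :
    |(b * d) / c| < (2 : ℝ) ^ (-1074 : ℤ) := by
  exact abs_mul_div_lt_of_abs_div_lt binary64_min_mul_max_le_one hc0 hc.2 h1 h2
end

section
/- Let α > 0 and Ω ≥ α be real numbers, let n ≥ 2 be a natural number, and let x_1, …, x_n be positive real numbers each lying in the interval [α, Ω]. If the product x_1·x_2·⋯·x_n also lies in [α, Ω], then the product (min_{i=1,…,n} x_i)·(max_{i=1,…,n} x_i) lies in [α, Ω]. -/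
/-- A function on a nontrivial finite type attains its minimum and its maximum at two distinct
points. -/
theorem exists_ne_forall_le_and_forall_ge {ι R : Type*} [Finite ι] [Nontrivial ι] [LinearOrder R]
    (x : ι → R) : ∃ i j, i ≠ j ∧ (∀ k, x i ≤ x k) ∧ ∀ k, x k ≤ x j := by
  obtain ⟨i, hi⟩ := Finite.exists_min x
  obtain ⟨j, hj⟩ := Finite.exists_max x
  by_cases hij : i = j
  · subst hij
    obtain ⟨k, hk⟩ := exists_ne i
    exact ⟨i, k, hk.symm, hi, fun l => (hj l).trans (hi k)⟩
  · exact ⟨i, j, hij, hi, hj⟩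

/-- Two distinct factors of a product of reals that are at least `1` have product at most the
whole product. -/
theorem mul_le_prod_of_one_le {ι : Type*} [Fintype ι] {x : ι → ℝ} (hx : ∀ k, 1 ≤ x k)
    {i j : ι} (hij : i ≠ j) : x i * x j ≤ ∏ k, x k := by
  classical
  rw [← Finset.prod_pair hij, ← Finset.prod_mul_prod_compl {i, j} x]
  refine le_mul_of_one_le_right (Finset.prod_nonneg fun k _ => zero_le_one.trans (hx k)) ?_
  simpa using Finset.prod_le_prod (s := ({i, j} : Finset ι)ᶜ) (fun _ _ => zero_le_one' ℝ)
    (fun k _ => hx k)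

/-- A product of reals in `[0, 1]` is at most the product of two of its distinct factors. -/
theorem prod_le_mul_of_le_one {ι : Type*} [Fintype ι] {x : ι → ℝ} (h₀ : ∀ k, 0 ≤ x k)
    (h₁ : ∀ k, x k ≤ 1) {i j : ι} (hij : i ≠ j) : ∏ k, x k ≤ x i * x j := by
  classical
  rw [← Finset.prod_pair hij, ← Finset.prod_mul_prod_compl {i, j} x]
  exact mul_le_of_le_one_right (Finset.prod_nonneg fun k _ => h₀ k)
    (Finset.prod_le_one (fun k _ => h₀ k) fun k _ => h₁ k)

/-- Stewart's theorem: if each `x i` is representable (lies in `[α, Ω]`) and the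
product of all of them is representable, then the product of the smallest of
them with the largest of them is representable. -/
theorem stewart_min_max_product
    (α Ω : ℝ) (hα : 0 < α) (hΩ : α ≤ Ω)
    (n : ℕ) (hn : 2 ≤ n) (x : Fin n → ℝ)
    (hpos : ∀ i, 0 < x i)
    (hx : ∀ i, x i ∈ Set.Icc α Ω)
    (hprod : (∏ i, x i) ∈ Set.Icc α Ω) :
    (Finset.univ.inf' ⟨⟨0, by omega⟩, Finset.mem_univ _⟩ x) *
      (Finset.univ.sup' ⟨⟨0, by omega⟩, Finset.mem_univ _⟩ x) ∈ Set.Icc α Ω := by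
  have : Nontrivial (Fin n) := Fin.nontrivial_iff_two_le.mpr hn
  obtain ⟨i, j, hij, hi, hj⟩ := exists_ne_forall_le_and_forall_ge x
  have hinf : Finset.univ.inf' ⟨⟨0, by omega⟩, Finset.mem_univ _⟩ x = x i :=
    le_antisymm (Finset.inf'_le x (Finset.mem_univ i)) (Finset.le_inf' _ _ fun k _ => hi k)
  have hsup : Finset.univ.sup' ⟨⟨0, by omega⟩, Finset.mem_univ _⟩ x = x j :=
    le_antisymm (Finset.sup'_le _ _ fun k _ => hj k) (Finset.le_sup' x (Finset.mem_univ j))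
  rw [hinf, hsup]
  constructor
  · rcases le_total 1 (x j) with h | h
    · exact (hx i).1.trans (le_mul_of_one_le_right (hpos i).le h)
    · exact hprod.1.trans
        (prod_le_mul_of_le_one (fun k => (hpos k).le) (fun k => (hj k).trans h) hij)
  · rcases le_total (x i) 1 with h | h
    · exact (mul_le_of_le_one_left (hpos j).le h).trans (hx j).2
    · exact (mul_le_prod_of_one_le (fun k => h.trans (hi k)) hij).trans hprod.2
end
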